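/- arXiv:2506.18494 — 2 statements merged into one kernel-verified Lean document; each statement's English description precedes it below -/
import Mathlib

section
/- Let A = {a₁, …, a_m} be a finite subset of E_q^n (q ≥ 2) with m = |A| ≥ 2, and let k be an integer with 0 ≤ k ≤ n, p(k) = min{|A|, q^k}. Then Σ_{e=2}^{p(k)} C(e, 2)·V(A, k, e) = Σ_{1 ≤ i < j ≤ m} C(n − d_{ij}, k − d_{ij}), where d_{ij} = d_H(a_i, a_j) and C(m', j') = 0 for j' < 0. -/
/-- The rank of a subset `A` of the cube `E_q^n`: the number of coordinates at which
`A` is not constant (the dimension of the smallest face containing `A`). -/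
def cubeRank {n q : ℕ} (A : Finset (Fin n → Fin q)) : ℕ :=
  (Finset.univ.filter fun i : Fin n => ∃ x ∈ A, ∃ y ∈ A, x i ≠ y i).card

/-- `F` is a `k`-dimensional face of `E_q^n`: all vectors agreeing with some fixed
values `c` outside a set `S` of `k` free coordinates. -/
def IsFace {n q : ℕ} (k : ℕ) (F : Finset (Fin n → Fin q)) : Prop :=
  ∃ S : Finset (Fin n), S.card = k ∧ ∃ c : Fin n → Fin q,
    F = Finset.univ.filter fun x => ∀ i ∉ S, x i = c i

/-- Binomial coefficient `C(m, j)` with an integer lower argument, equal to `0` for `j < 0`. -/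
def chooseZ (m : ℕ) (j : ℤ) : ℕ := if j < 0 then 0 else m.choose j.toNat

/-- The face through `x` with set of free coordinates `S`. -/
def cubeFace {n q : ℕ} (S : Finset (Fin n)) (x : Fin n → Fin q) : Finset (Fin n → Fin q) :=
  Finset.univ.filter fun y => ∀ i ∉ S, y i = x i

theorem mem_cubeFace {n q : ℕ} {S : Finset (Fin n)} {x y : Fin n → Fin q} :
    y ∈ cubeFace S x ↔ ∀ i ∉ S, y i = x i := by
  simp [cubeFace]

theorem card_cubeFace {n q : ℕ} (S : Finset (Fin n)) (x : Fin n → Fin q) :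
    (cubeFace S x).card = q ^ S.card := by
  have h : cubeFace S x = Fintype.piFinset fun i => if i ∈ S then Finset.univ else {x i} := by
    ext y
    simp only [mem_cubeFace, Fintype.mem_piFinset]
    refine forall_congr' fun i => ?_
    by_cases hi : i ∈ S <;> simp [hi]
  rw [h, Fintype.card_piFinset]
  simp [apply_ite Finset.card]

theorem cubeFace_eq_of_mem {n q : ℕ} {S : Finset (Fin n)} {x y : Fin n → Fin q}
    (h : y ∈ cubeFace S x) : cubeFace S x = cubeFace S y := by
  ext z
  simp only [mem_cubeFace] at h ⊢
  exact forall₂_congr fun i hi => by rw [h i hi]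

theorem cubeFace_left_injective {n q : ℕ} (hq : 2 ≤ q) (x : Fin n → Fin q) :
    Function.Injective fun S => cubeFace S x := by
  have : Nontrivial (Fin q) := Fin.nontrivial_iff_two_le.mpr hq
  have key : ∀ S T, cubeFace S x = cubeFace T x → S ⊆ T := by
    intro S T h i hi
    by_contra hT
    obtain ⟨v, hv⟩ := exists_ne (x i)
    have hmem : Function.update x i v ∈ cubeFace S x := by
      rw [mem_cubeFace]
      intro j hj
      exact Function.update_of_ne (by rintro rfl; exact hj hi) _ _
    rw [h, mem_cubeFace] at hmem
    exact hv (by simpa using hmem i hT)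
  exact fun S T h => (key S T h).antisymm (key T S h.symm)

theorem isFace_iff_exists_cubeFace {n q k : ℕ} {F : Finset (Fin n → Fin q)} :
    IsFace k F ↔ ∃ S : Finset (Fin n), S.card = k ∧ ∃ c, F = cubeFace S c :=
  Iff.rfl

theorem IsFace.card_eq {n q k : ℕ} {F : Finset (Fin n → Fin q)} (h : IsFace k F) :
    F.card = q ^ k := by
  obtain ⟨S, rfl, c, rfl⟩ := isFace_iff_exists_cubeFace.mp h
  exact card_cubeFace S c

theorem card_filter_superset_powersetCard {α : Type*} [Fintype α] [DecidableEq α]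
    (D : Finset α) (k : ℕ) :
    ((Finset.powersetCard k Finset.univ).filter fun S => D ⊆ S).card =
      chooseZ (Fintype.card α - D.card) ((k : ℤ) - D.card) := by
  unfold chooseZ
  split_ifs with h
  · rw [Finset.card_eq_zero, Finset.filter_eq_empty_iff]
    intro S hS hD
    have h1 := Finset.card_le_card hD
    rw [(Finset.mem_powersetCard.mp hS).2] at h1
    omega
  · have h2 : ((k : ℤ) - D.card).toNat = k - D.card := by omega
    rw [h2, ← Finset.card_compl, ← Finset.card_powersetCard]
    refine Finset.card_nbij' (fun S => S \ D) (fun T => T ∪ D) ?_ ?_ ?_ ?_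
    · intro S hS
      simp only [Finset.coe_filter, Finset.mem_powersetCard, Set.mem_ofPred_eq] at hS
      simp only [Finset.mem_coe, Finset.mem_powersetCard]
      refine ⟨fun i hi => by simp_all, ?_⟩
      rw [Finset.card_sdiff_of_subset hS.2, hS.1.2]
    · intro T hT
      simp only [Finset.mem_coe, Finset.mem_powersetCard] at hT
      simp only [Finset.coe_filter, Finset.mem_powersetCard, Set.mem_ofPred_eq]
      refine ⟨⟨Finset.subset_univ _, ?_⟩, Finset.subset_union_right⟩
      rw [Finset.card_union_of_disjoint (Finset.subset_compl_iff_disjoint_right.mp hT.1), hT.2]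
      omega
    · intro S hS
      simp only [Finset.coe_filter, Set.mem_ofPred_eq] at hS
      exact Finset.sdiff_union_of_subset hS.2
    · intro T hT
      simp only [Finset.mem_coe, Finset.mem_powersetCard] at hT
      exact Finset.union_sdiff_cancel_right (Finset.subset_compl_iff_disjoint_right.mp hT.1)

open Classical in
theorem card_filter_isFace_mem_mem {n q : ℕ} (hq : 2 ≤ q) (k : ℕ) (x y : Fin n → Fin q) :
    (Finset.univ.filter fun F => IsFace k F ∧ x ∈ F ∧ y ∈ F).card =
      chooseZ (n - hammingDist x y) ((k : ℤ) - hammingDist x y) := by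
  have h := card_filter_superset_powersetCard (Finset.univ.filter fun i => x i ≠ y i) k
  rw [Fintype.card_fin] at h
  refine Eq.trans ?_ h
  rw [← Finset.card_image_of_injective _ (cubeFace_left_injective hq x)]
  congr 1
  ext F
  have hsub (S : Finset (Fin n)) :
      (Finset.univ.filter fun i => x i ≠ y i) ⊆ S ↔ y ∈ cubeFace S x := by
    simp only [Finset.subset_iff, mem_cubeFace, Finset.mem_filter, Finset.mem_univ, true_and]
    exact forall_congr' fun i => by rw [eq_comm, not_imp_comm]
  simp only [Finset.mem_filter, Finset.mem_univ, true_and, Finset.mem_image, hsub,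
    Finset.mem_powersetCard, Finset.subset_univ]
  constructor
  · rintro ⟨⟨S, hS, c, rfl⟩, hx, hy⟩
    have he := cubeFace_eq_of_mem (S := S) hx
    exact ⟨S, ⟨hS, he ▸ hy⟩, he.symm⟩
  · rintro ⟨S, ⟨hS, hy⟩, rfl⟩
    exact ⟨⟨S, hS, x, rfl⟩, mem_cubeFace.mpr fun _ _ => rfl, hy⟩

theorem Finset.sum_card_filter_lt_eq_choose_two {α : Type*} [LinearOrder α] (B : Finset α) :
    ∑ i ∈ B, (B.filter fun j => i < j).card = B.card.choose 2 := by
  induction B using Finset.induction_on_min with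
  | empty => simp
  | insert b B hb ih =>
    have hnot : b ∉ B := fun h => lt_irrefl _ (hb b h)
    rw [Finset.sum_insert hnot, Finset.card_insert_of_notMem hnot, Nat.choose_succ_succ,
      Nat.choose_one_right, ← ih]
    congr 1
    · rw [Finset.filter_insert, if_neg (lt_irrefl b), Finset.filter_true_of_mem hb]
    · refine Finset.sum_congr rfl fun i hi => ?_
      rw [Finset.filter_insert, if_neg (hb i hi).not_gt]

theorem identity_s_two {n q m : ℕ} (hq : 2 ≤ q) (hm : 2 ≤ m)
    (a : Fin m → (Fin n → Fin q)) (ha : Function.Injective a)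
    (A : Finset (Fin n → Fin q)) (hA : A = Finset.image a Finset.univ)
    (k : ℕ) (hk : k ≤ n) :
    ∑ e ∈ Finset.Icc 2 (min A.card (q ^ k)),
        e.choose 2 *
          {F : Finset (Fin n → Fin q) | IsFace k F ∧ (A ∩ F).card = e}.ncard =
      ∑ i : Fin m, ∑ j ∈ Finset.univ.filter fun j => i < j,
        chooseZ (n - hammingDist (a i) (a j)) ((k : ℤ) - hammingDist (a i) (a j)) := by
  classical
  set Φ : Finset (Finset (Fin n → Fin q)) := Finset.univ.filter fun F => IsFace k F with hΦ
  have hcard (e : ℕ) : {F : Finset (Fin n → Fin q) | IsFace k F ∧ (A ∩ F).card = e}.ncard =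
      (Φ.filter fun F => (A ∩ F).card = e).card := by
    rw [← Set.ncard_coe_finset]
    congr 1
    ext F
    simp [hΦ]
  have hpairs (F : Finset (Fin n → Fin q)) : (A ∩ F).card.choose 2 =
      ∑ i : Fin m, ∑ j ∈ Finset.univ.filter fun j => i < j,
        if a i ∈ F ∧ a j ∈ F then 1 else 0 := by
    have himage : A ∩ F = (Finset.univ.filter fun i => a i ∈ F).image a := by
      rw [hA]
      ext x
      simp only [Finset.mem_inter, Finset.mem_image, Finset.mem_filter, Finset.mem_univ, true_and]
      constructor
      · rintro ⟨⟨i, rfl⟩, h⟩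
        exact ⟨i, h, rfl⟩
      · rintro ⟨i, h, rfl⟩
        exact ⟨⟨i, rfl⟩, h⟩
    rw [himage, Finset.card_image_of_injective _ ha, ← Finset.sum_card_filter_lt_eq_choose_two,
      Finset.sum_filter]
    refine Finset.sum_congr rfl fun i _ => ?_
    by_cases hi : a i ∈ F
    · simp only [hi, if_true, true_and, ← Finset.card_filter, Finset.filter_filter, and_comm]
    · simp [hi]
  have hfiber : ∑ e ∈ Finset.Icc 2 (min A.card (q ^ k)),
        e.choose 2 * (Φ.filter fun F => (A ∩ F).card = e).card =
      ∑ F ∈ Φ, (A ∩ F).card.choose 2 := by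
    have hbound : ∀ F ∈ Φ, (A ∩ F).card ≤ min A.card (q ^ k) := fun F hF =>
      le_min (Finset.card_le_card Finset.inter_subset_left)
        ((Finset.mem_filter.mp hF).2.card_eq ▸ Finset.card_le_card Finset.inter_subset_right)
    simp only [Finset.card_filter, Finset.mul_sum]
    rw [Finset.sum_comm]
    refine Finset.sum_congr rfl fun F hF => ?_
    simp only [mul_ite, mul_one, mul_zero, Finset.sum_ite_eq, Finset.mem_Icc]
    split_ifs with h
    · rfl
    · exact (Nat.choose_eq_zero_of_lt (by have := hbound F hF; omega)).symm
  simp only [hcard]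
  rw [hfiber]
  simp only [hpairs]
  rw [Finset.sum_comm]
  refine Finset.sum_congr rfl fun i _ => ?_
  rw [Finset.sum_comm]
  refine Finset.sum_congr rfl fun j _ => ?_
  rw [← card_filter_isFace_mem_mem hq, ← Finset.card_filter, hΦ, Finset.filter_filter]
end

section
/- Let A = {a₁, …, a_m} be a finite subset of the binary cube E_2^n with m = |A| ≥ 3, and let k be an integer with 0 ≤ k ≤ n, p(k) = min{|A|, 2^k}. Then Σ_{e=3}^{p(k)} C(e, 3)·V(A, k, e) = Σ_{1 ≤ i < j < t ≤ m} C(n − d_{ijt}, k − d_{ijt}), where d_{ijt} = (d_H(a_i,a_j) + d_H(a_i,a_t) + d_H(a_j,a_t))/2 and C(m', j') = 0 for j' < 0. -/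
/-- The face through `x` whose free coordinates are those in `S`. -/
def faceThrough {n : ℕ} (x : Fin n → Fin 2) (S : Finset (Fin n)) : Finset (Fin n → Fin 2) :=
  Finset.univ.filter fun w => ∀ i ∉ S, w i = x i

theorem mem_faceThrough {n : ℕ} {x w : Fin n → Fin 2} {S : Finset (Fin n)} :
    w ∈ faceThrough x S ↔ ∀ i ∉ S, w i = x i := by
  simp [faceThrough]

theorem faceThrough_injective {n : ℕ} (x : Fin n → Fin 2) :
    Function.Injective (faceThrough x) := by
  have key : ∀ (S : Finset (Fin n)) (i : Fin n),
      Function.update x i (x i + 1) ∈ faceThrough x S ↔ i ∈ S := by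
    intro S i
    rw [mem_faceThrough]
    constructor
    · intro h
      by_contra hi
      have := h i hi
      simp at this
    · intro hi j hj
      rw [Function.update_of_ne]
      rintro rfl
      exact hj hi
  intro S T h
  ext i
  rw [← key S, ← key T, h]

theorem isFace_and_mem_iff {n k : ℕ} (x : Fin n → Fin 2) (F : Finset (Fin n → Fin 2)) :
    IsFace k F ∧ x ∈ F ↔ ∃ S : Finset (Fin n), S.card = k ∧ F = faceThrough x S := by
  constructor
  · rintro ⟨⟨S, hS, c, rfl⟩, hx⟩
    refine ⟨S, hS, ?_⟩
    simp only [Finset.mem_filter, Finset.mem_univ, true_and] at hx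
    ext w
    simp only [Finset.mem_filter, Finset.mem_univ, true_and, mem_faceThrough]
    exact forall₂_congr fun i hi => by rw [hx i hi]
  · rintro ⟨S, hS, rfl⟩
    exact ⟨⟨S, hS, x, rfl⟩, mem_faceThrough.2 fun _ _ => rfl⟩

theorem IsFace.card_le {n k : ℕ} {F : Finset (Fin n → Fin 2)} (hF : IsFace k F) :
    F.card ≤ 2 ^ k := by
  obtain ⟨S, hS, c, rfl⟩ := hF
  have h : (Finset.univ : Finset (S → Fin 2)).card = 2 ^ k := by simp [hS]
  rw [← h]
  refine Finset.card_le_card_of_injOn (fun w i => w i)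
    (fun _ _ => Finset.mem_coe.2 (Finset.mem_univ _)) ?_
  intro v hv w hw hvw
  simp only [Finset.coe_filter, Finset.mem_univ, true_and, Set.mem_ofPred_eq] at hv hw
  funext i
  by_cases hi : i ∈ S
  · exact congrFun hvw ⟨i, hi⟩
  · rw [hv i hi, hw i hi]

theorem card_powersetCard_filter_superset {n : ℕ} (k : ℕ) (D : Finset (Fin n)) :
    ((Finset.powersetCard k Finset.univ).filter fun S => D ⊆ S).card =
      chooseZ (n - D.card) ((k : ℤ) - D.card) := by
  unfold chooseZ
  split_ifs with h
  · rw [Finset.card_eq_zero, Finset.filter_eq_empty_iff]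
    intro S hS hD
    have := Finset.card_le_card hD
    rw [(Finset.mem_powersetCard.1 hS).2] at this
    omega
  · have hk : ((k : ℤ) - D.card).toNat = k - D.card := by omega
    have hc : n - D.card = (Dᶜ).card := by rw [Finset.card_compl, Fintype.card_fin]
    rw [hk, hc, ← Finset.card_powersetCard]
    refine Finset.card_nbij' (fun S => S \ D) (fun S => S ∪ D) ?_ ?_ ?_ ?_
    · intro S hS
      simp only [Finset.coe_filter, Finset.mem_powersetCard, Finset.subset_univ, true_and,
        Set.mem_ofPred_eq, Finset.mem_coe] at hS ⊢
      refine ⟨fun i hi => ?_, ?_⟩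
      · simp at hi ⊢
        exact hi.2
      · rw [Finset.card_sdiff_of_subset hS.2, hS.1]
    · intro S hS
      simp only [Finset.coe_filter, Finset.mem_powersetCard, Finset.subset_univ, true_and,
        Set.mem_ofPred_eq, Finset.mem_coe] at hS ⊢
      refine ⟨?_, Finset.subset_union_right⟩
      rw [Finset.card_union_of_disjoint, hS.2]
      · omega
      · exact Finset.subset_compl_iff_disjoint_right.1 hS.1
    · intro S hS
      simp only [Finset.coe_filter, Set.mem_ofPred_eq] at hS
      exact Finset.sdiff_union_of_subset hS.2
    · intro S hS
      simp only [Finset.mem_powersetCard, Finset.mem_coe] at hS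
      exact Finset.union_sdiff_cancel_right (Finset.subset_compl_iff_disjoint_right.1 hS.1)

theorem hammingDist_triple_div_two {n : ℕ} (x y z : Fin n → Fin 2) :
    (hammingDist x y + hammingDist x z + hammingDist y z) / 2 =
      (Finset.univ.filter fun i => x i ≠ y i ∨ x i ≠ z i).card := by
  have h : hammingDist x y + hammingDist x z + hammingDist y z =
      2 * (Finset.univ.filter fun i => x i ≠ y i ∨ x i ≠ z i).card := by
    simp only [hammingDist, Finset.card_filter, Finset.mul_sum, ← Finset.sum_add_distrib]
    refine Finset.sum_congr rfl fun i _ => ?_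
    generalize x i = p
    generalize y i = q
    generalize z i = r
    revert p q r
    decide
  omega

open Classical in
theorem card_faces_triple {n : ℕ} (k : ℕ) (x y z : Fin n → Fin 2) :
    (Finset.univ.filter fun F : Finset (Fin n → Fin 2) =>
        IsFace k F ∧ x ∈ F ∧ y ∈ F ∧ z ∈ F).card =
      chooseZ (n - (hammingDist x y + hammingDist x z + hammingDist y z) / 2)
        ((k : ℤ) - ((hammingDist x y + hammingDist x z + hammingDist y z) / 2 : ℕ)) := by
  rw [hammingDist_triple_div_two, ← card_powersetCard_filter_superset,
    ← Finset.card_image_of_injective _ (faceThrough_injective x)]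
  congr 1
  have hsub : ∀ S : Finset (Fin n), y ∈ faceThrough x S ∧ z ∈ faceThrough x S ↔
      (Finset.univ.filter fun i => x i ≠ y i ∨ x i ≠ z i) ⊆ S := by
    intro S
    simp only [mem_faceThrough, Finset.subset_iff, Finset.mem_filter, Finset.mem_univ, true_and]
    constructor
    · rintro ⟨hy, hz⟩ i hi
      by_contra hS
      exact hi.elim (fun h => h (hy i hS).symm) (fun h => h (hz i hS).symm)
    · intro h
      refine ⟨fun i hi => ?_, fun i hi => ?_⟩
      · by_contra hne
        exact hi (h (Or.inl (Ne.symm hne)))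
      · by_contra hne
        exact hi (h (Or.inr (Ne.symm hne)))
  ext F
  simp only [Finset.mem_filter, Finset.mem_univ, true_and, Finset.mem_image,
    Finset.mem_powersetCard, Finset.subset_univ]
  rw [← and_assoc, isFace_and_mem_iff]
  constructor
  · rintro ⟨⟨S, hS, rfl⟩, h⟩
    exact ⟨S, ⟨hS, (hsub S).1 h⟩, rfl⟩
  · rintro ⟨S, ⟨hS, h⟩, rfl⟩
    exact ⟨⟨S, hS, rfl⟩, (hsub S).2 h⟩

/-- The increasing triples in a finite set are counted by its 3-element subsets. -/
theorem card_increasing_triples {α : Type*} [Fintype α] [LinearOrder α] (s : Finset α) :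
    (Finset.univ.filter fun p : α × α × α =>
        p.1 < p.2.1 ∧ p.2.1 < p.2.2 ∧ p.1 ∈ s ∧ p.2.1 ∈ s ∧ p.2.2 ∈ s).card =
      s.card.choose 3 := by
  rw [← Finset.card_powersetCard]
  refine Finset.card_nbij (fun p => {p.1, p.2.1, p.2.2}) ?_ ?_ ?_
  · rintro ⟨i, j, t⟩ h
    simp only [Finset.coe_filter, Finset.mem_univ, true_and, Set.mem_ofPred_eq] at h
    obtain ⟨hij, hjt, hi, hj, ht⟩ := h
    simp only [Finset.mem_coe, Finset.mem_powersetCard]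
    refine ⟨?_, Finset.card_eq_three.2
      ⟨i, j, t, hij.ne, (hij.trans hjt).ne, hjt.ne, rfl⟩⟩
    simp [Finset.insert_subset_iff, hi, hj, ht]
  · rintro ⟨i, j, t⟩ h ⟨i', j', t'⟩ h' heq
    simp only [Finset.coe_filter, Finset.mem_univ, true_and, Set.mem_ofPred_eq] at h h'
    have hmem : ∀ w, w = i ∨ w = j ∨ w = t ↔ w = i' ∨ w = j' ∨ w = t' := by
      intro w
      have := congrArg (w ∈ ·) heq
      simpa using this
    have h1 := (hmem i).1 (by simp)
    have h2 := (hmem j).1 (by simp)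
    have h3 := (hmem t).1 (by simp)
    have h1' := (hmem i').2 (by simp)
    have h2' := (hmem j').2 (by simp)
    have h3' := (hmem t').2 (by simp)
    simp only [Prod.mk.injEq]
    grind
  · intro T hT
    simp only [Finset.mem_coe, Finset.mem_powersetCard] at hT
    have hr := T.range_orderEmbOfFin hT.2
    set f := T.orderEmbOfFin hT.2 with hf
    have hfs : ∀ u, f u ∈ s := fun u => hT.1 (T.orderEmbOfFin_mem hT.2 u)
    refine ⟨(f 0, f 1, f 2), ?_, ?_⟩
    · simp [hfs]
    · apply Finset.coe_injective
      rw [← hr]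
      ext w
      simp [Fin.exists_fin_succ, eq_comm]

theorem sum_choose_mul_card_filter {β : Type*} (s : Finset β) (f : β → ℕ) (r M : ℕ)
    (hf : ∀ b ∈ s, f b ≤ M) :
    ∑ e ∈ Finset.Icc r M, e.choose r * (s.filter fun b => f b = e).card =
      ∑ b ∈ s, (f b).choose r := by
  simp only [Finset.card_filter, Finset.mul_sum]
  rw [Finset.sum_comm]
  refine Finset.sum_congr rfl fun b hb => ?_
  simp only [mul_ite, mul_one, mul_zero, Finset.sum_ite_eq, Finset.mem_Icc]
  split_ifs with h
  · rfl
  · rw [Nat.choose_eq_zero_of_lt]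
    have := hf b hb
    omega

theorem identity_s_three {n m : ℕ} (hm : 3 ≤ m)
    (a : Fin m → (Fin n → Fin 2)) (ha : Function.Injective a)
    (A : Finset (Fin n → Fin 2)) (hA : A = Finset.image a Finset.univ)
    (k : ℕ) (hk : k ≤ n) :
    ∑ e ∈ Finset.Icc 3 (min A.card (2 ^ k)),
        e.choose 3 *
          {F : Finset (Fin n → Fin 2) | IsFace k F ∧ (A ∩ F).card = e}.ncard =
      ∑ i : Fin m, ∑ j ∈ Finset.univ.filter (fun j => i < j),
        ∑ t ∈ Finset.univ.filter fun t => j < t,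
          let d := (hammingDist (a i) (a j) + hammingDist (a i) (a t) +
            hammingDist (a j) (a t)) / 2
          chooseZ (n - d) ((k : ℤ) - d) := by
  classical
  have hset : ∀ e, {F : Finset (Fin n → Fin 2) | IsFace k F ∧ (A ∩ F).card = e}.ncard =
      ((Finset.univ.filter fun F : Finset (Fin n → Fin 2) => IsFace k F).filter
        fun F => (A ∩ F).card = e).card := by
    intro e
    rw [← Set.ncard_coe_finset]
    congr 1
    ext F
    simp
  simp only [hset]
  rw [sum_choose_mul_card_filter]
  swap
  · intro F hF
    rw [Finset.mem_filter] at hF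
    exact le_min (Finset.card_le_card Finset.inter_subset_left)
      ((Finset.card_le_card Finset.inter_subset_right).trans hF.2.card_le)
  have hcard : ∀ F : Finset (Fin n → Fin 2),
      (A ∩ F).card = (Finset.univ.filter fun i => a i ∈ F).card := by
    intro F
    rw [← Finset.card_image_of_injective _ ha, hA]
    congr 1
    ext w
    simp only [Finset.mem_inter, Finset.mem_image, Finset.mem_filter, Finset.mem_univ, true_and]
    constructor
    · rintro ⟨⟨i, rfl⟩, h⟩
      exact ⟨i, h, rfl⟩
    · rintro ⟨i, h, rfl⟩
      exact ⟨⟨i, rfl⟩, h⟩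
  simp only [hcard, ← card_increasing_triples, ← card_faces_triple]
  simp only [Finset.card_filter, Fintype.sum_prod_type, Finset.mem_filter, Finset.mem_univ,
    true_and]
  rw [Finset.sum_comm]
  refine Finset.sum_congr rfl fun i _ => ?_
  rw [Finset.sum_comm, Finset.sum_filter]
  refine Finset.sum_congr rfl fun j _ => ?_
  rw [Finset.sum_comm, Finset.sum_filter]
  by_cases hij : i < j
  · simp only [hij, true_and, if_true]
    refine Finset.sum_congr rfl fun t _ => ?_
    by_cases hjt : j < t
    · simp [hjt, Finset.filter_filter]
    · simp [hjt]
  · simp [hij]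
end
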